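/- arXiv:2012.14946 — 6 statements merged into one kernel-verified Lean document; each statement's English description precedes it below -/
import Mathlib

section
/- For all integers r, t with 0 ≤ t ≤ r, the following identity holds in ℚ: C(r,t) · Σ_{j=0}^{t} (−1)^j · C(t,j) / (r + j − t + 1) = 1/(r+1). -/
theorem alternating_choose_sum_succ {R : Type*} [CommRing R] (f : ℕ → R) (t : ℕ) :
    ∑ j ∈ Finset.range (t + 2), (-1 : R) ^ j * ((t + 1).choose j : R) * f j =
      ∑ j ∈ Finset.range (t + 1), (-1 : R) ^ j * (t.choose j : R) * f j -
        ∑ j ∈ Finset.range (t + 1), (-1 : R) ^ j * (t.choose j : R) * f (j + 1) := by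
  have h : ∑ j ∈ Finset.range (t + 1), (-1 : R) ^ j * (t.choose j : R) * f j =
      ∑ j ∈ Finset.range (t + 2), (-1 : R) ^ j * (t.choose j : R) * f j := by
    simp [Finset.sum_range_succ _ (t + 1)]
  rw [h, Finset.sum_range_succ' _ (t + 1), Finset.sum_range_succ' _ (t + 1),
    add_sub_right_comm, ← Finset.sum_sub_distrib]
  congr 1
  · refine Finset.sum_congr rfl fun j _ => ?_
    rw [Nat.choose_succ_succ]
    push_cast
    ring
  · simp

theorem alternating_choose_sum_inv {K : Type*} [Field K] [CharZero K] (t m : ℕ) :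
    ∑ j ∈ Finset.range (t + 1), (-1 : K) ^ j * (t.choose j : K) * ((m + j + 1 : ℕ) : K)⁻¹ =
      (((m + t + 1 : ℕ) : K) * ((m + t).choose t : K))⁻¹ := by
  induction t generalizing m with
  | zero => simp
  | succ t ih =>
    rw [alternating_choose_sum_succ (fun j => ((m + j + 1 : ℕ) : K)⁻¹), ih m]
    have h := ih (m + 1)
    simp only [show ∀ j, m + 1 + j + 1 = m + (j + 1) + 1 by intro j; ring,
      show m + 1 + t = m + t + 1 by ring] at h
    rw [h]
    have h₁ : ((m + t + 1 : ℕ) : K) * ((m + t).choose t : K) =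
        ((m + t + 1).choose (t + 1) : K) * (t + 1) := by
      exact_mod_cast Nat.add_one_mul_choose_eq (m + t) t
    have h₂ : ((m + t + 1).choose (t + 1) : K) * (t + 1) =
        ((m + t + 1).choose t : K) * (m + 1) := by
      have := Nat.choose_succ_right_eq (m + t + 1) t
      rw [show m + t + 1 - t = m + 1 by omega] at this
      exact_mod_cast this
    have hB : ((m + t + 1).choose t : K) ≠ 0 :=
      Nat.cast_ne_zero.mpr (Nat.choose_pos (by omega)).ne'
    have hm : (m + 1 : K) ≠ 0 := by exact_mod_cast m.succ_ne_zero
    have ht : (t + 1 : K) ≠ 0 := by exact_mod_cast t.succ_ne_zero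
    have hs : (m + t + 1 + 1 : K) ≠ 0 := by exact_mod_cast (m + t + 1).succ_ne_zero
    have h₃ : ((m + t + 1).choose (t + 1) : K) =
        ((m + t + 1).choose t : K) * (m + 1) / (t + 1) := by
      rw [← h₂]; field_simp
    rw [h₁, h₂, ← add_assoc m t 1, h₃]
    push_cast
    field_simp
    ring

/-- For integers `0 ≤ t ≤ r`, the identity
`C(r,t) · Σ_{j=0}^{t} (−1)^j C(t,j)/(r+j−t+1) = 1/(r+1)` holds in `ℚ`. -/
theorem binomial_reciprocal_sum (r t : ℕ) (ht : t ≤ r) :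
    (r.choose t : ℚ) *
        ∑ j ∈ Finset.range (t + 1),
          (-1 : ℚ) ^ j * (t.choose j : ℚ) / ((r : ℚ) + (j : ℚ) - (t : ℚ) + 1)
      = 1 / ((r : ℚ) + 1) := by
  obtain ⟨m, rfl⟩ := Nat.exists_eq_add_of_le' ht
  have h := alternating_choose_sum_inv (K := ℚ) t m
  have hc : ((m + t).choose t : ℚ) ≠ 0 := Nat.cast_ne_zero.mpr (Nat.choose_pos ht).ne'
  have hsum : ∑ j ∈ Finset.range (t + 1),
      (-1 : ℚ) ^ j * (t.choose j : ℚ) / (((m + t : ℕ) : ℚ) + (j : ℚ) - (t : ℚ) + 1) =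
      (((m + t + 1 : ℕ) : ℚ) * ((m + t).choose t : ℚ))⁻¹ := by
    rw [← h]
    refine Finset.sum_congr rfl fun j _ => ?_
    rw [div_eq_mul_inv]
    congr 2
    push_cast
    ring
  rw [hsum, mul_inv, mul_left_comm, mul_inv_cancel₀ hc]
  simp
end

section
/- Let λ_0, λ_1, λ_2, λ_3 be pairwise distinct complex numbers. Then Σ_{0≤i<j≤3} (λ_i + λ_j)^4 / D_{ij} = 2. -/
open Finset in
/-- Bott denominator: `D_{ij} = ∏_{k ≠ i,j} (λ_i − λ_k)(λ_j − λ_k)`. -/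
noncomputable def bottD {n : ℕ} (l : Fin n → ℂ) (i j : Fin n) : ℂ :=
  ∏ k ∈ (Finset.univ \ {i, j}), (l i - l k) * (l j - l k)

/-- `P_c(x,y) = Σ_{t=0}^{c−1} x^t y^{c−1−t}`. -/
noncomputable def bottP (c : ℕ) (x y : ℂ) : ℂ :=
  ∑ t ∈ Finset.range c, x ^ t * y ^ (c - 1 - t)

/-- Bott's formula for `N_1(3,0) = 2`: contact lines in ℙ³ meeting 3 general lines. -/
theorem bott_sum_7 (l : Fin 4 → ℂ) (hl : Function.Injective l) :
    ∑ p ∈ Finset.univ.filter (fun p : Fin 4 × Fin 4 => p.1 < p.2),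
      (l p.1 + l p.2) ^ 4 / bottD l p.1 p.2 = 2 := by
  have hfilter : Finset.univ.filter (fun p : Fin 4 × Fin 4 => p.1 < p.2) =
      {(0, 1), (0, 2), (0, 3), (1, 2), (1, 3), (2, 3)} := by decide
  have hsub : ∀ {i j : Fin 4}, i ≠ j → l i - l j ≠ 0 := fun h => sub_ne_zero.mpr (hl.ne h)
  have D01 : bottD l 0 1 =
      (l 0 - l 2) * (l 1 - l 2) * ((l 0 - l 3) * (l 1 - l 3)) := by
    rw [bottD, show (Finset.univ \ {0, 1} : Finset (Fin 4)) = {2, 3} by decide,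
      Finset.prod_pair (by decide)]
  have D02 : bottD l 0 2 =
      (l 0 - l 1) * (l 2 - l 1) * ((l 0 - l 3) * (l 2 - l 3)) := by
    rw [bottD, show (Finset.univ \ {0, 2} : Finset (Fin 4)) = {1, 3} by decide,
      Finset.prod_pair (by decide)]
  have D03 : bottD l 0 3 =
      (l 0 - l 1) * (l 3 - l 1) * ((l 0 - l 2) * (l 3 - l 2)) := by
    rw [bottD, show (Finset.univ \ {0, 3} : Finset (Fin 4)) = {1, 2} by decide,
      Finset.prod_pair (by decide)]
  have D12 : bottD l 1 2 =
      (l 1 - l 0) * (l 2 - l 0) * ((l 1 - l 3) * (l 2 - l 3)) := by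
    rw [bottD, show (Finset.univ \ {1, 2} : Finset (Fin 4)) = {0, 3} by decide,
      Finset.prod_pair (by decide)]
  have D13 : bottD l 1 3 =
      (l 1 - l 0) * (l 3 - l 0) * ((l 1 - l 2) * (l 3 - l 2)) := by
    rw [bottD, show (Finset.univ \ {1, 3} : Finset (Fin 4)) = {0, 2} by decide,
      Finset.prod_pair (by decide)]
  have D23 : bottD l 2 3 =
      (l 2 - l 0) * (l 3 - l 0) * ((l 2 - l 1) * (l 3 - l 1)) := by
    rw [bottD, show (Finset.univ \ {2, 3} : Finset (Fin 4)) = {0, 1} by decide,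
      Finset.prod_pair (by decide)]
  have h01 : l 0 - l 1 ≠ 0 := hsub (by decide)
  have h02 : l 0 - l 2 ≠ 0 := hsub (by decide)
  have h03 : l 0 - l 3 ≠ 0 := hsub (by decide)
  have h12 : l 1 - l 2 ≠ 0 := hsub (by decide)
  have h13 : l 1 - l 3 ≠ 0 := hsub (by decide)
  have h23 : l 2 - l 3 ≠ 0 := hsub (by decide)
  rw [hfilter]
  simp only [Finset.sum_insert, Finset.mem_insert, Finset.mem_singleton, Prod.mk.injEq,
    Finset.sum_singleton, Fin.reduceEq, and_false, and_true, or_self, not_false_eq_true,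
    D01, D02, D03, D12, D13, D23]
  generalize l 0 = a at h01 h02 h03 ⊢
  generalize l 1 = b at h01 h12 h13 ⊢
  generalize l 2 = c at h02 h12 h23 ⊢
  generalize l 3 = d at h03 h13 h23 ⊢
  rw [← neg_sub a b, ← neg_sub a c, ← neg_sub b c, ← neg_sub a d, ← neg_sub b d,
    ← neg_sub c d]
  field_simp
  ring
end

section
/- Let λ_0, λ_1, λ_2, λ_3 be pairwise distinct complex numbers. Then Σ_{0≤i<j≤3} (λ_i + λ_j)^2 · (λ_i^2 + λ_i λ_j + λ_j^2) / D_{ij} = 1. -/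
/-- Bott's formula for `N_1(1,1) = 1`: contact lines in ℙ³ meeting 1 general line and 1 general point. -/
theorem bott_sum_8 (l : Fin 4 → ℂ) (hl : Function.Injective l) :
    ∑ p ∈ Finset.univ.filter (fun p : Fin 4 × Fin 4 => p.1 < p.2),
      (l p.1 + l p.2) ^ 2 * ((l p.1) ^ 2 + l p.1 * l p.2 + (l p.2) ^ 2) / bottD l p.1 p.2 = 1 := by
  have h : ∀ i j : Fin 4, i ≠ j → l i - l j ≠ 0 := fun i j hij =>
    sub_ne_zero.mpr (hl.ne hij)
  have h01 := h 0 1 (by decide)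
  have h02 := h 0 2 (by decide)
  have h03 := h 0 3 (by decide)
  have h12 := h 1 2 (by decide)
  have h13 := h 1 3 (by decide)
  have h23 := h 2 3 (by decide)
  have hpairs : Finset.univ.filter (fun p : Fin 4 × Fin 4 => p.1 < p.2) =
      {(0, 1), (0, 2), (0, 3), (1, 2), (1, 3), (2, 3)} := by decide
  have c01 : (Finset.univ \ {0, 1} : Finset (Fin 4)) = {2, 3} := by decide
  have c02 : (Finset.univ \ {0, 2} : Finset (Fin 4)) = {1, 3} := by decide
  have c03 : (Finset.univ \ {0, 3} : Finset (Fin 4)) = {1, 2} := by decide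
  have c12 : (Finset.univ \ {1, 2} : Finset (Fin 4)) = {0, 3} := by decide
  have c13 : (Finset.univ \ {1, 3} : Finset (Fin 4)) = {0, 2} := by decide
  have c23 : (Finset.univ \ {2, 3} : Finset (Fin 4)) = {0, 1} := by decide
  rw [hpairs]
  repeat rw [Finset.sum_insert (by decide)]
  rw [Finset.sum_singleton]
  simp only [bottD, c01, c02, c03, c12, c13, c23]
  rw [Finset.prod_pair (by decide), Finset.prod_pair (by decide), Finset.prod_pair (by decide),
    Finset.prod_pair (by decide), Finset.prod_pair (by decide), Finset.prod_pair (by decide)]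
  rw [← neg_sub (l 0) (l 1), ← neg_sub (l 0) (l 2), ← neg_sub (l 0) (l 3),
    ← neg_sub (l 1) (l 2), ← neg_sub (l 1) (l 3), ← neg_sub (l 2) (l 3)]
  generalize l 0 = a at *
  generalize l 1 = b at *
  generalize l 2 = c at *
  generalize l 3 = d at *
  field_simp
  ring
end

section
/- Let λ_0, …, λ_5 be pairwise distinct complex numbers. Then Σ_{0≤i<j≤5} (λ_i + λ_j)^8 / D_{ij} = 14. -/
/-- Over distinct nodes `v`, the divided-difference functional kills the powers of exponent less
than `#s - 1`, and takes the value `1` on the power of exponent `#s - 1`. -/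
theorem sum_pow_div_prod_sub {F ι : Type*} [Field F] [DecidableEq ι] {s : Finset ι} {v : ι → F}
    (hv : Set.InjOn v s) {m : ℕ} (hm : m < s.card) :
    ∑ i ∈ s, v i ^ m / ∏ j ∈ s.erase i, (v i - v j) = if s.card - 1 = m then 1 else 0 := by
  have h := Lagrange.coeff_eq_sum hv (P := (Polynomial.X ^ m : Polynomial F))
    (by rw [Polynomial.degree_X_pow]; exact_mod_cast hm)
  simpa [Polynomial.coeff_X_pow] using h.symm

/-- A symmetric function vanishing on the diagonal has total sum twice the sum over `i < j`. -/
theorem sum_sum_eq_two_mul_sum_filter_lt {ι R : Type*} [Fintype ι] [LinearOrder ι] [CommRing R]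
    (f : ι → ι → R) (hsymm : ∀ i j, f i j = f j i) (hdiag : ∀ i, f i i = 0) :
    ∑ i, ∑ j, f i j = 2 * ∑ p ∈ Finset.univ.filter (fun p : ι × ι => p.1 < p.2), f p.1 p.2 := by
  have hsplit (i j : ι) :
      f i j = (if i < j then f i j else 0) + (if j < i then f j i else 0) := by
    rcases lt_trichotomy i j with h | rfl | h
    · simp [h, h.not_gt]
    · simp [hdiag]
    · simp [h, h.not_gt, hsymm i j]
  rw [Finset.sum_filter, Fintype.sum_prod_type, two_mul,
    Finset.sum_congr rfl fun i _ => Finset.sum_congr rfl fun j _ => hsplit i j]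
  simp only [Finset.sum_add_distrib]
  congr 1
  exact Finset.sum_comm

/-- The Bott denominator in terms of the products `∏_{k ≠ i} (λ_i − λ_k)`. -/
theorem bottD_mul_sub_sq {n : ℕ} (l : Fin n → ℂ) {i j : Fin n} (hij : i ≠ j) :
    bottD l i j * -(l i - l j) ^ 2 =
      (∏ k ∈ Finset.univ.erase i, (l i - l k)) * ∏ k ∈ Finset.univ.erase j, (l j - l k) := by
  have hi : (Finset.univ \ {i, j} : Finset (Fin n)) = (Finset.univ.erase i).erase j := by
    ext; simp; tauto
  have hj : (Finset.univ \ {i, j} : Finset (Fin n)) = (Finset.univ.erase j).erase i := by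
    ext; simp
  rw [bottD, Finset.prod_mul_distrib]
  nth_rewrite 1 [hi]
  rw [hj, ← Finset.mul_prod_erase (Finset.univ.erase i) _ (by simpa using hij.symm : j ∈ _),
    ← Finset.mul_prod_erase (Finset.univ.erase j) _ (by simpa using hij : i ∈ _)]
  ring

/-- Bott's formula for `N_1(7,0,0,0) = 14` in ℙ⁵. -/
theorem bott_sum_9 (l : Fin 6 → ℂ) (hl : Function.Injective l) :
    ∑ p ∈ Finset.univ.filter (fun p : Fin 6 × Fin 6 => p.1 < p.2),
      (l p.1 + l p.2) ^ 8 / bottD l p.1 p.2 = 14 := by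
  set W : Fin 6 → ℂ := fun i => ∏ k ∈ Finset.univ.erase i, (l i - l k)
  set S : ℕ → ℂ := fun m => ∑ i, l i ^ m / W i with hS
  have hmoment (m : ℕ) (hm : m < 6) : S m = if 5 = m then 1 else 0 := by
    simpa using sum_pow_div_prod_sub (s := Finset.univ) hl.injOn (m := m) (by simpa using hm)
  have hterm (p : Fin 6 × Fin 6) (hp : p ∈ Finset.univ.filter fun p : Fin 6 × Fin 6 => p.1 < p.2) :
      (l p.1 + l p.2) ^ 8 / bottD l p.1 p.2 =
        -((l p.1 - l p.2) ^ 2 * (l p.1 + l p.2) ^ 8 / (W p.1 * W p.2)) := by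
    have hne : p.1 ≠ p.2 := (Finset.mem_filter.mp hp).2.ne
    have hsub : -(l p.1 - l p.2) ^ 2 ≠ 0 :=
      neg_ne_zero.mpr (pow_ne_zero 2 (sub_ne_zero.mpr (hl.ne hne)))
    rw [← bottD_mul_sub_sq l hne, ← mul_div_mul_right _ _ hsub]
    ring
  have hexpand : ∑ i, ∑ j, (l i - l j) ^ 2 * (l i + l j) ^ 8 / (W i * W j) =
      S 0 * S 10 + 6 * (S 1 * S 9) + 13 * (S 2 * S 8) + 8 * (S 3 * S 7) - 14 * (S 4 * S 6)
        - 28 * (S 5 * S 5) - 14 * (S 6 * S 4) + 8 * (S 7 * S 3) + 13 * (S 8 * S 2)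
        + 6 * (S 9 * S 1) + S 10 * S 0 := by
    simp only [hS, Finset.sum_mul_sum]
    simp only [Finset.mul_sum, ← Finset.sum_add_distrib, ← Finset.sum_sub_distrib]
    refine Finset.sum_congr rfl fun i _ => Finset.sum_congr rfl fun j _ => ?_
    ring
  have hhalf := sum_sum_eq_two_mul_sum_filter_lt
    (fun i j => (l i - l j) ^ 2 * (l i + l j) ^ 8 / (W i * W j))
    (fun i j => by ring) (fun i => by simp)
  rw [hexpand, hmoment 0 (by simp), hmoment 1 (by simp), hmoment 2 (by simp),
    hmoment 3 (by simp), hmoment 4 (by simp), hmoment 5 (by simp)] at hhalf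
  rw [Finset.sum_congr rfl hterm, Finset.sum_neg_distrib]
  norm_num at hhalf
  linear_combination hhalf / 2
end

section
/- Let λ_0, …, λ_5 be pairwise distinct complex numbers. Then Σ_{0≤i<j≤5} (λ_i + λ_j)^5 · P_4(λ_i,λ_j) / D_{ij} = 4. -/
open Finset in
/-- `w_i = ∏_{k ≠ i} (λ_i − λ_k)`, the derivative at `λ_i` of the polynomial with roots `λ`. -/
noncomputable def nodeWeight {n : ℕ} (l : Fin n → ℂ) (i : Fin n) : ℂ :=
  ∏ k ∈ univ.erase i, (l i - l k)

theorem nodeWeight_ne_zero {n : ℕ} {l : Fin n → ℂ} (hl : Function.Injective l) (i : Fin n) :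
    nodeWeight l i ≠ 0 :=
  Finset.prod_ne_zero_iff.2 fun _ hk =>
    sub_ne_zero.2 fun h => (Finset.ne_of_mem_erase hk) (hl h).symm

theorem sum_pow_div_nodeWeight {n : ℕ} {l : Fin n → ℂ} (hl : Function.Injective l) {a : ℕ}
    (ha : a < n) : ∑ i, l i ^ a / nodeWeight l i = if n - 1 = a then 1 else 0 := by
  have h := Lagrange.coeff_eq_sum (s := Finset.univ) (v := l) hl.injOn
    (P := (Polynomial.X ^ a : Polynomial ℂ)) (by simpa using ha)
  simpa [Polynomial.coeff_X_pow, nodeWeight] using h.symm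

theorem nodeWeight_mul_nodeWeight {n : ℕ} (l : Fin n → ℂ) {i j : Fin n} (hij : i ≠ j) :
    nodeWeight l i * nodeWeight l j = -(l i - l j) ^ 2 * bottD l i j := by
  have hi : nodeWeight l i = (l i - l j) * ∏ k ∈ Finset.univ \ {i, j}, (l i - l k) := by
    rw [nodeWeight, ← Finset.mul_prod_erase _ _ (Finset.mem_erase.2 ⟨hij.symm, Finset.mem_univ j⟩)]
    congr 2
    ext k
    simp [and_comm]
  have hj : nodeWeight l j = (l j - l i) * ∏ k ∈ Finset.univ \ {i, j}, (l j - l k) := by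
    rw [nodeWeight, ← Finset.mul_prod_erase _ _ (Finset.mem_erase.2 ⟨hij, Finset.mem_univ i⟩)]
    congr 2
    ext k
    simp
  rw [hi, hj, bottD, Finset.prod_mul_distrib]
  ring

theorem div_bottD {n : ℕ} {l : Fin n → ℂ} (hl : Function.Injective l) {i j : Fin n}
    (hij : i ≠ j) (z : ℂ) :
    z / bottD l i j = -(l i - l j) ^ 2 * z / (nodeWeight l i * nodeWeight l j) := by
  have h : -(l i - l j) ^ 2 ≠ 0 := neg_ne_zero.2 (pow_ne_zero 2 (sub_ne_zero.2 (hl.ne hij)))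
  rw [nodeWeight_mul_nodeWeight l hij, mul_div_mul_left _ _ h]

theorem sum_eq_two_mul_sum_filter_lt {n : ℕ} (f : Fin n → Fin n → ℂ)
    (hsymm : ∀ i j, f i j = f j i) (hdiag : ∀ i, f i i = 0) :
    ∑ i, ∑ j, f i j =
      2 * ∑ p ∈ Finset.univ.filter (fun p : Fin n × Fin n => p.1 < p.2), f p.1 p.2 := by
  have hsplit : ∀ i j, f i j = (if i < j then f i j else 0) + (if j < i then f j i else 0) := by
    intro i j
    rcases lt_trichotomy i j with h | rfl | h
    · simp [h, h.not_gt]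
    · simp [hdiag]
    · simp [h, h.not_gt, hsymm i j]
  rw [Finset.sum_filter, Fintype.sum_prod_type, two_mul]
  conv_lhs => enter [2, i, 2, j]; rw [hsplit]
  simp only [Finset.sum_add_distrib]
  congr 1
  exact Finset.sum_comm

/-- Bott's formula for `N_1(4,0,1,0) = 4` in ℙ⁵. -/
theorem bott_sum_11 (l : Fin 6 → ℂ) (hl : Function.Injective l) :
    ∑ p ∈ Finset.univ.filter (fun p : Fin 6 × Fin 6 => p.1 < p.2),
      (l p.1 + l p.2) ^ 5 * bottP 4 (l p.1) (l p.2) / bottD l p.1 p.2 = 4 := by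
  set f : Fin 6 → Fin 6 → ℂ := fun i j =>
    -(l i - l j) ^ 2 * ((l i + l j) ^ 5 * bottP 4 (l i) (l j)) /
      (nodeWeight l i * nodeWeight l j) with hf
  set u : ℕ → Fin 6 → ℂ := fun a i => l i ^ a / nodeWeight l i with hu
  have hexpand : ∀ i j, f i j = -(u 10 i * u 0 j) - 4 * (u 9 i * u 1 j) - 5 * (u 8 i * u 2 j)
      + 6 * (u 6 i * u 4 j) + 8 * (u 5 i * u 5 j) + 6 * (u 4 i * u 6 j)
      - 5 * (u 2 i * u 8 j) - 4 * (u 1 i * u 9 j) - u 0 i * u 10 j := by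
    intro i j
    have hi := nodeWeight_ne_zero hl i
    have hj := nodeWeight_ne_zero hl j
    simp only [hf, hu, bottP, Finset.sum_range_succ, Finset.sum_range_zero]
    field_simp
    ring
  have hmoment : ∀ a < 6, ∑ i, u a i = if 5 = a then 1 else 0 := fun a ha =>
    sum_pow_div_nodeWeight hl ha
  have htotal : ∑ i, ∑ j, f i j = 8 := by
    simp only [hexpand, Finset.sum_add_distrib, Finset.sum_sub_distrib, Finset.sum_neg_distrib,
      ← Finset.mul_sum, ← Finset.sum_mul]
    simp [hmoment]
  have hhalf := sum_eq_two_mul_sum_filter_lt f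
    (fun i j => by rw [hexpand, hexpand]; ring) (fun i => by simp [hf])
  have hsum : ∑ p ∈ Finset.univ.filter (fun p : Fin 6 × Fin 6 => p.1 < p.2),
      (l p.1 + l p.2) ^ 5 * bottP 4 (l p.1) (l p.2) / bottD l p.1 p.2 =
      ∑ p ∈ Finset.univ.filter (fun p : Fin 6 × Fin 6 => p.1 < p.2), f p.1 p.2 :=
    Finset.sum_congr rfl fun p hp => div_bottD hl (Finset.mem_filter.1 hp).2.ne _
  rw [hsum]
  linear_combination (htotal - hhalf) / 2
end

section
/- Let λ_0, …, λ_5 be pairwise distinct complex numbers. Then Σ_{0≤i<j≤5} (λ_i + λ_j)^3 · P_3(λ_i,λ_j) · P_4(λ_i,λ_j) / D_{ij} = 3. -/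
/-- A symmetric function vanishing on the diagonal sums to twice its sum over `i < j`. -/
theorem sum_sum_eq_two_mul_sum_lt {ι R : Type*} [Fintype ι] [LinearOrder ι] [CommSemiring R]
    (f : ι → ι → R) (hsymm : ∀ i j, f i j = f j i) (hdiag : ∀ i, f i i = 0) :
    ∑ i, ∑ j, f i j =
      2 * ∑ p ∈ Finset.univ.filter (fun p : ι × ι => p.1 < p.2), f p.1 p.2 := by
  have hsplit (i j : ι) :
      f i j = (if i < j then f i j else 0) + (if j < i then f j i else 0) := by
    rcases lt_trichotomy i j with h | rfl | h
    · simp [h, h.not_gt]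
    · simp [hdiag]
    · simp [h, h.not_gt, hsymm i j]
  rw [Finset.sum_filter, Fintype.sum_prod_type, two_mul]
  calc ∑ i, ∑ j, f i j
      = ∑ i, ∑ j, ((if i < j then f i j else 0) + (if j < i then f j i else 0)) :=
        Finset.sum_congr rfl fun i _ => Finset.sum_congr rfl fun j _ => hsplit i j
    _ = _ := by
        simp only [Finset.sum_add_distrib]
        congr 1
        exact Finset.sum_comm

open Lagrange in
/-- The power sums weighted by the nodal weights vanish below degree `n` and equal `1` there. -/
theorem sum_pow_mul_nodalWeight {F : Type*} [Field F] {n : ℕ} (l : Fin (n + 1) → F)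
    (hl : Function.Injective l) {m : ℕ} (hm : m ≤ n) :
    ∑ i, l i ^ m * nodalWeight Finset.univ l i = if m = n then 1 else 0 := by
  have h := coeff_eq_sum (s := Finset.univ) (v := l) hl.injOn (P := Polynomial.X ^ m) (by
    rw [Polynomial.degree_X_pow, Finset.card_univ, Fintype.card_fin]
    exact_mod_cast Nat.lt_succ_of_le hm)
  simp only [Polynomial.coeff_X_pow, Finset.card_univ, Fintype.card_fin, Nat.add_sub_cancel,
    Polynomial.eval_pow, Polynomial.eval_X, div_eq_mul_inv, ← Finset.prod_inv_distrib] at h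
  simp only [nodalWeight, ← h, eq_comm]

theorem bottP_mul_sub (c : ℕ) (x y : ℂ) : bottP c x y * (x - y) = x ^ c - y ^ c :=
  (Commute.all x y).geom_sum₂_mul c

open Lagrange in
theorem inv_bottD {n : ℕ} (l : Fin n → ℂ) (hl : Function.Injective l) {i j : Fin n}
    (hij : i ≠ j) :
    (bottD l i j)⁻¹ =
      -(l i - l j) ^ 2 * (nodalWeight Finset.univ l i * nodalWeight Finset.univ l j) := by
  have hsub : l i - l j ≠ 0 := sub_ne_zero.mpr (hl.ne hij)
  have hsub' : l j - l i ≠ 0 := sub_ne_zero.mpr (hl.ne hij.symm)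
  have hi : nodalWeight Finset.univ l i =
      (l i - l j)⁻¹ * ∏ k ∈ Finset.univ \ {i, j}, (l i - l k)⁻¹ := by
    rw [nodalWeight,
      ← Finset.mul_prod_erase _ _ (Finset.mem_erase.mpr ⟨hij.symm, Finset.mem_univ j⟩)]
    congr 2
    grind
  have hj : nodalWeight Finset.univ l j =
      (l j - l i)⁻¹ * ∏ k ∈ Finset.univ \ {i, j}, (l j - l k)⁻¹ := by
    rw [nodalWeight,
      ← Finset.mul_prod_erase _ _ (Finset.mem_erase.mpr ⟨hij, Finset.mem_univ i⟩)]
    congr 2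
    grind
  rw [hi, hj, bottD, ← Finset.prod_inv_distrib]
  simp only [mul_inv, Finset.prod_mul_distrib]
  field_simp
  ring

/-- Bott's formula for `N_1(2,1,1,0) = 3` in ℙ⁵. -/
theorem bott_sum_13 (l : Fin 6 → ℂ) (hl : Function.Injective l) :
    ∑ p ∈ Finset.univ.filter (fun p : Fin 6 × Fin 6 => p.1 < p.2),
      (l p.1 + l p.2) ^ 3 * bottP 3 (l p.1) (l p.2) * bottP 4 (l p.1) (l p.2) / bottD l p.1 p.2 = 3 := by
  set W := Lagrange.nodalWeight Finset.univ l with hW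
  let f (i j : Fin 6) : ℂ :=
    -((l i + l j) ^ 3 * (l i ^ 3 - l j ^ 3) * (l i ^ 4 - l j ^ 4)) * (W i * W j)
  have hterm : ∀ p ∈ Finset.univ.filter (fun p : Fin 6 × Fin 6 => p.1 < p.2),
      (l p.1 + l p.2) ^ 3 * bottP 3 (l p.1) (l p.2) * bottP 4 (l p.1) (l p.2) / bottD l p.1 p.2 =
        f p.1 p.2 := by
    intro p hp
    rw [div_eq_mul_inv, inv_bottD l hl (Finset.mem_filter.mp hp).2.ne]
    simp only [f, ← bottP_mul_sub, hW]
    ring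
  rw [Finset.sum_congr rfl hterm]
  have htwice := sum_sum_eq_two_mul_sum_lt f (fun i j => by simp only [f]; ring)
    (fun i => by simp [f])
  let M (m : ℕ) : ℂ := ∑ i, l i ^ m * W i
  have hM {m : ℕ} (hm : m ≤ 5) : M m = if m = 5 then 1 else 0 :=
    sum_pow_mul_nodalWeight l hl hm
  have hexpand : ∑ i, ∑ j, f i j =
      6 * (M 5 * M 5) + 4 * (M 6 * M 4 + M 4 * M 6) - 3 * (M 8 * M 2 + M 2 * M 8)
        - 3 * (M 9 * M 1 + M 1 * M 9) - (M 10 * M 0 + M 0 * M 10) := by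
    simp only [M, Finset.sum_mul_sum]
    simp only [Finset.mul_sum, ← Finset.sum_add_distrib, ← Finset.sum_sub_distrib]
    refine Finset.sum_congr rfl fun i _ => Finset.sum_congr rfl fun j _ => ?_
    simp only [f]
    ring
  have hsix : ∑ i, ∑ j, f i j = 6 := by
    rw [hexpand, hM (m := 0) (by simp), hM (m := 1) (by simp), hM (m := 2) (by simp),
      hM (m := 4) (by simp), hM (m := 5) le_rfl]
    norm_num
  linear_combination (hsix - htwice) / 2
end
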